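/- Let s ∈ (0,1). There exists a constant C = C(s) > 0 such that for every t ≥ 0 and every measurable w = (w₁,w₂,w₃) : ℝ³ → ℂ³ satisfying ξ₁w₁(ξ) + ξ₂w₂(ξ) + ξ₃w₃(ξ) = 0 for almost every ξ ∈ ℝ³, one has ∫_{ℝ³} e^{−2t|ξ_h|²} |w₃(ξ)|² dξ ≤ C · (1+t)^{−(3s/2 + 1/4)} · ( ∫_{ℝ³} |w₃(ξ)|² dξ + ∫_{ℝ³} |ξ_h|^{−2s} |ξ₃|^{−(s+1/2)} (|w₁(ξ)|² + |w₂(ξ)|² + |w₃(ξ)|²) dξ ). -/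

import Mathlib

open MeasureTheory
open scoped ENNReal

noncomputable section

/-- `|ξ_h| = (ξ₁² + ξ₂²)^{1/2}`, the magnitude of the horizontal frequencies. -/
def hmag (ξ : EuclideanSpace ℝ (Fin 3)) : ℝ := Real.sqrt (ξ 0 ^ 2 + ξ 1 ^ 2)

theorem rpow_le_two_mul_exp_two_mul {a y : ℝ} (ha : 0 ≤ a) (ha2 : a ≤ 2) (hy : 0 ≤ y) :
    y ^ a ≤ 2 * Real.exp (2 * y) := by
  have hsq : y ^ a ≤ 1 + y ^ 2 := by
    rcases le_total y 1 with h | h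
    · have := Real.rpow_le_one hy h ha
      nlinarith [sq_nonneg y]
    · have := Real.rpow_le_rpow_of_exponent_le h ha2
      rw [Real.rpow_two] at this
      linarith
  have := Real.quadratic_le_exp_of_nonneg (x := 2 * y) (by positivity)
  nlinarith [sq_nonneg y]

theorem le_rpow_mul_of_le_of_le_sq_mul {b r m n : ℝ} (hb : 0 ≤ b) (hb2 : b ≤ 2) (hr : 0 < r)
    (hn : 0 ≤ n) (hmn : m ≤ n) (hm : m ≤ r ^ 2 * n) : m ≤ r ^ b * n := by
  rcases le_total r 1 with h | h
  · refine hm.trans (mul_le_mul_of_nonneg_right ?_ hn)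
    rw [← Real.rpow_two]
    exact Real.rpow_le_rpow_of_exponent_ge hr h hb2
  · exact hmn.trans (le_mul_of_one_le_left hn (Real.one_le_rpow h hb))

/-- Pointwise frequency-side bound behind the decay estimate: if `z² m ≤ h² n`, one may trade
the factor `(h / z) ^ (s + 1 / 2)` for decay in time. -/
theorem exp_mul_le_decay_mul {s t h z m n : ℝ} (hs : 0 < s) (hs1 : s < 1) (ht : 0 ≤ t)
    (hh : 0 ≤ h) (hz : 0 < z) (hm : 0 ≤ m) (hmn : m ≤ n) (hdiv : z ^ 2 * m ≤ h ^ 2 * n) :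
    Real.exp (-(2 * t * h ^ 2)) * m ≤ 8 * (1 + t) ^ (-(3 * s / 2 + 1 / 4)) *
      (m + h ^ (-(2 * s)) * z ^ (-(s + 1 / 2)) * n) := by
  have hn : 0 ≤ n := hm.trans hmn
  set a := 3 * s / 2 + 1 / 4 with ha
  set W := h ^ (-(2 * s)) * z ^ (-(s + 1 / 2)) * n with hW
  have hW0 : 0 ≤ W := by positivity
  have h1t : 0 < 1 + t := by linarith
  have htwo : (2 : ℝ) ^ a ≤ 4 := by
    have := Real.rpow_le_rpow_of_exponent_le (x := 2) (by norm_num) (show a ≤ 2 by linarith)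
    rw [Real.rpow_two] at this
    linarith
  suffices key : (1 + t) ^ a * (Real.exp (-(2 * t * h ^ 2)) * m) ≤ 8 * (m + W) by
    rw [Real.rpow_neg h1t.le, ← div_eq_mul_inv, div_mul_eq_mul_div,
      le_div_iff₀ (Real.rpow_pos_of_pos h1t a)]
    linarith
  rcases le_total t 1 with ht1 | ht1
  · have h1 : (1 + t) ^ a ≤ 4 :=
      (Real.rpow_le_rpow h1t.le (by linarith) (by positivity)).trans htwo
    have h2 : Real.exp (-(2 * t * h ^ 2)) * m ≤ m :=
      mul_le_of_le_one_left hm (Real.exp_le_one_iff.2 (by nlinarith [mul_nonneg ht (sq_nonneg h)]))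
    have := mul_le_mul h1 h2 (by positivity) (by norm_num)
    linarith
  · rcases hh.eq_or_lt with rfl | hh
    · have : m = 0 := by
        have : 0 < z ^ 2 := by positivity
        nlinarith
      simp only [this, mul_zero]
      positivity
    have h1 : (1 + t) ^ a ≤ 4 * t ^ a := by
      calc (1 + t) ^ a ≤ (2 * t) ^ a := Real.rpow_le_rpow h1t.le (by linarith) (by positivity)
        _ = 2 ^ a * t ^ a := Real.mul_rpow (by norm_num) ht
        _ ≤ 4 * t ^ a := by gcongr
    have h2 : m ≤ (h ^ 2) ^ a * W := by
      have hr : m ≤ (h / z) ^ (s + 1 / 2) * n := by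
        refine le_rpow_mul_of_le_of_le_sq_mul (by linarith) (by linarith) (by positivity) hn hmn ?_
        rw [div_pow, div_mul_eq_mul_div, le_div_iff₀ (by positivity)]
        linarith
      convert hr using 1
      rw [hW, Real.div_rpow hh.le hz.le, Real.rpow_neg hz.le, ← Real.rpow_natCast h 2,
        ← Real.rpow_mul hh.le, ← mul_assoc, ← mul_assoc, ← Real.rpow_add hh, div_eq_mul_inv]
      congr 3
      rw [ha]
      push_cast
      ring
    have h3 : Real.exp (-(2 * t * h ^ 2)) * (t ^ a * (h ^ 2) ^ a) ≤ 2 := by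
      rw [← Real.mul_rpow ht (sq_nonneg h), Real.exp_neg, ← div_eq_inv_mul,
        div_le_iff₀ (Real.exp_pos _), mul_assoc 2 t]
      exact rpow_le_two_mul_exp_two_mul (by positivity) (by linarith) (by positivity)
    calc (1 + t) ^ a * (Real.exp (-(2 * t * h ^ 2)) * m)
        ≤ (4 * t ^ a) * (Real.exp (-(2 * t * h ^ 2)) * ((h ^ 2) ^ a * W)) := by gcongr
      _ = 4 * (Real.exp (-(2 * t * h ^ 2)) * (t ^ a * (h ^ 2) ^ a)) * W := by ring
      _ ≤ 4 * 2 * W := by gcongr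
      _ ≤ 8 * (m + W) := by linarith

theorem sq_mul_norm_sq_le_of_sum_mul_eq_zero {x y z : ℝ} {u v w : ℂ}
    (h : (x : ℂ) * u + (y : ℂ) * v + (z : ℂ) * w = 0) :
    z ^ 2 * ‖w‖ ^ 2 ≤ (x ^ 2 + y ^ 2) * (‖u‖ ^ 2 + ‖v‖ ^ 2) := by
  have hzw : ‖(z : ℂ) * w‖ ≤ ‖(x : ℂ) * u‖ + ‖(y : ℂ) * v‖ := by
    rw [eq_neg_of_add_eq_zero_right h, norm_neg]
    exact norm_add_le _ _
  simp only [norm_mul, Complex.norm_real, Real.norm_eq_abs] at hzw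
  have hsq := pow_le_pow_left₀ (by positivity) hzw 2
  rw [mul_pow, sq_abs] at hsq
  nlinarith [sq_nonneg (|x| * ‖v‖ - |y| * ‖u‖), sq_abs x, sq_abs y]

theorem ae_euclideanSpace_apply_ne_zero {ι : Type*} [Fintype ι] (i : ι) :
    ∀ᵐ ξ : EuclideanSpace ℝ ι, ξ i ≠ 0 := by
  classical
  have hker : LinearMap.ker (EuclideanSpace.proj i : EuclideanSpace ℝ ι →L[ℝ] ℝ).toLinearMap
      ≠ ⊤ := by
    intro htop
    have : EuclideanSpace.single i (1 : ℝ) ∈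
        LinearMap.ker (EuclideanSpace.proj i : EuclideanSpace ℝ ι →L[ℝ] ℝ).toLinearMap :=
      htop ▸ Submodule.mem_top
    simp at this
  have := Measure.addHaar_submodule (volume : Measure (EuclideanSpace ℝ ι)) _ hker
  rw [ae_iff]
  convert this using 2
  ext ξ
  simp

/-- Enhanced decay of the horizontal heat evolution of the third component of a
divergence-free field: for `s ∈ (0,1)` there is `C > 0` so that for all `t ≥ 0` and
measurable `w : ℝ³ → ℂ³` with `ξ·w(ξ) = 0` a.e.,
`∫ e^{−2t|ξ_h|²} |w₃|² ≤ C ⟨t⟩^{−(3s/2+1/4)} (∫ |w₃|² + ∫ |ξ_h|^{−2s} |ξ₃|^{−(s+1/2)} |w|²)`. -/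
theorem heat_third_component_decay (s : ℝ) (hs : s ∈ Set.Ioo (0 : ℝ) 1) :
    ∃ C : ℝ, 0 < C ∧ ∀ t : ℝ, 0 ≤ t →
      ∀ w : EuclideanSpace ℝ (Fin 3) → Fin 3 → ℂ, Measurable w →
        (∀ᵐ ξ : EuclideanSpace ℝ (Fin 3),
          (ξ 0 : ℂ) * w ξ 0 + (ξ 1 : ℂ) * w ξ 1 + (ξ 2 : ℂ) * w ξ 2 = 0) →
        (∫⁻ ξ : EuclideanSpace ℝ (Fin 3),
            ENNReal.ofReal (Real.exp (-(2 * t * hmag ξ ^ 2))) * ENNReal.ofReal (‖w ξ 2‖ ^ 2))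
          ≤ ENNReal.ofReal (C * (1 + t) ^ (-(3 * s / 2 + 1 / 4)))
            * ((∫⁻ ξ : EuclideanSpace ℝ (Fin 3), ENNReal.ofReal (‖w ξ 2‖ ^ 2))
              + ∫⁻ ξ : EuclideanSpace ℝ (Fin 3),
                  ENNReal.ofReal (hmag ξ ^ (-(2 * s)) * |ξ 2| ^ (-(s + 1 / 2))
                    * (‖w ξ 0‖ ^ 2 + ‖w ξ 1‖ ^ 2 + ‖w ξ 2‖ ^ 2))) := by
  obtain ⟨hs0, hs1⟩ := hs
  refine ⟨8, by norm_num, fun t ht w hw hdiv => ?_⟩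
  have hmeas : Measurable fun ξ : EuclideanSpace ℝ (Fin 3) => ENNReal.ofReal (‖w ξ 2‖ ^ 2) :=
    (((measurable_pi_apply 2).comp hw).norm.pow_const 2).ennreal_ofReal
  rw [← lintegral_add_left hmeas, ← lintegral_const_mul' _ _ ENNReal.ofReal_ne_top]
  refine lintegral_mono_ae ?_
  filter_upwards [hdiv, ae_euclideanSpace_apply_ne_zero (2 : Fin 3)] with ξ hξ hz
  have hh : 0 ≤ hmag ξ := Real.sqrt_nonneg _
  have hhsq : hmag ξ ^ 2 = ξ 0 ^ 2 + ξ 1 ^ 2 := Real.sq_sqrt (by positivity)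
  rw [← ENNReal.ofReal_mul (Real.exp_pos _).le, ← ENNReal.ofReal_add (by positivity)
    (by positivity), ← ENNReal.ofReal_mul (by positivity)]
  refine ENNReal.ofReal_le_ofReal
    (exp_mul_le_decay_mul hs0 hs1 ht hh (abs_pos.2 hz) (by positivity) ?_ ?_)
  · linarith [sq_nonneg ‖w ξ 0‖, sq_nonneg ‖w ξ 1‖]
  · rw [sq_abs, hhsq]
    refine (sq_mul_norm_sq_le_of_sum_mul_eq_zero hξ).trans ?_
    exact mul_le_mul_of_nonneg_left (le_add_of_nonneg_right (by positivity)) (by positivity)
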